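/- Given positive integers d, s, m, if 0 < ε ≤ ε0(d,s,m) is sufficiently small, then there exist α = α(d,s,m) > 0 and a positive integer M = M(d,s,m) such that the following holds. Let (F_1, …, F_{d+1}) be an (M,1,s,ε)-rainbow (d+1)-tuple of families of convex sets in ℝ^d. Then there exists a family F* of convex sets in ℝ^d of size m such that no s distinct members of F* have a common point, and there exist subfamilies F_i' ⊆ F_i for i = 2, …, d+1 such that (F*, F_2', …, F_{d+1}') is (m,α,s,ε)-rainbow. -/

import Mathlib

open MeasureTheory

/-- A (d+1)-tuple of families of convex sets in ℝ^d is (m, α, s, ε)-rainbow if each family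
has m members, every colorful selection has intersection of volume at least α, and any s
distinct members of a single family have intersection of volume at most ε. -/
def IsRainbow (d m s : ℕ) (α ε : ℝ)
    (F : Fin (d + 1) → Finset (Set (EuclideanSpace ℝ (Fin d)))) : Prop :=
  (∀ i, ∀ A ∈ F i, Convex ℝ A) ∧
  (∀ i, (F i).card = m) ∧
  (∀ A : Fin (d + 1) → Set (EuclideanSpace ℝ (Fin d)),
    (∀ i, A i ∈ F i) → ENNReal.ofReal α ≤ volume (⋂ i, A i)) ∧
  (∀ i, ∀ B ⊆ F i, B.card = s →
    volume (⋂₀ (B : Set (Set (EuclideanSpace ℝ (Fin d))))) ≤ ENNReal.ofReal ε)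

/-- Asymmetric finite Ramsey theorem for hypergraphs. -/
theorem exists_monochromatic_subset_sizes {α κ : Type*} [Finite κ] (r : ℕ) (n : κ → ℕ) :
    ∃ M : ℕ, ∀ V : Finset α, M ≤ V.card → ∀ χ : Finset α → κ,
      ∃ c, ∃ H ⊆ V, H.card = n c ∧ ∀ B ⊆ H, B.card = r → χ B = c := by
  classical
  cases nonempty_fintype κ
  induction r generalizing n with
  | zero =>
    refine ⟨∑ c, n c, fun V hV χ => ?_⟩
    obtain ⟨H, hHV, hH⟩ := Finset.exists_subset_card_eq
      ((Finset.single_le_sum (fun _ _ => Nat.zero_le _) (Finset.mem_univ (χ ∅))).trans hV)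
    refine ⟨χ ∅, H, hHV, hH, fun B _ hB => ?_⟩
    rw [Finset.card_eq_zero.1 hB]
  | succ r ih =>
    induction hN : ∑ c, n c generalizing n with
    | zero =>
      refine ⟨0, fun V _ χ => ⟨χ ∅, ∅, by simp, ?_, fun B hB hc => ?_⟩⟩
      · simpa using (Finset.sum_eq_zero_iff.1 hN (χ ∅) (Finset.mem_univ _)).symm
      · simp [Finset.subset_empty.1 hB] at hc
    | succ N ihN =>
      by_cases h0 : ∃ c, n c = 0
      · obtain ⟨c, hc⟩ := h0
        refine ⟨0, fun V _ χ => ⟨c, ∅, by simp, by simp [hc], fun B hB h => ?_⟩⟩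
        simp [Finset.subset_empty.1 hB] at h
      push Not at h0
      have hdec : ∀ c, ∑ c', Function.update n c (n c - 1) c' = N := fun c => by
        have h1 := Finset.sum_update_of_mem (Finset.mem_univ c) n (n c - 1)
        have h2 := Finset.add_sum_erase Finset.univ n (Finset.mem_univ c)
        rw [Finset.erase_eq] at h2
        have := h0 c
        omega
      choose K hK using fun c => ihN (Function.update n c (n c - 1)) (hdec c)
      obtain ⟨L, hL⟩ := ih (fun _ => ∑ c, K c)
      refine ⟨L + 1, fun V hV χ => ?_⟩
      obtain ⟨x, hx⟩ := Finset.card_pos.1 (Nat.lt_of_lt_of_le (Nat.succ_pos L) hV)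
      obtain ⟨c₀, W, hWV, hW, hcol⟩ := hL (V.erase x)
        (by rw [Finset.card_erase_of_mem hx]; omega) (fun B => χ (insert x B))
      obtain ⟨c, H, hHW, hH, hmono⟩ := hK c₀ W
        (by rw [hW]; exact Finset.single_le_sum (fun _ _ => Nat.zero_le _) (Finset.mem_univ c₀)) χ
      have hHV : H ⊆ V := hHW.trans (hWV.trans (Finset.erase_subset _ _))
      by_cases hcc : c = c₀
      · subst hcc
        have hxH : x ∉ H := fun h => by simpa using hWV (hHW h)
        refine ⟨c, insert x H, Finset.insert_subset hx hHV, ?_, fun B hB hBc => ?_⟩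
        · rw [Finset.card_insert_of_notMem hxH, hH, Function.update_self]
          have := h0 c
          omega
        · by_cases hxB : x ∈ B
          · have := hcol (B.erase x) (((Finset.subset_insert_iff).1 hB).trans hHW)
              (by rw [Finset.card_erase_of_mem hxB]; omega)
            rwa [Finset.insert_erase hxB] at this
          · exact hmono B ((Finset.subset_insert_iff_of_notMem hxB).1 hB) hBc
      · refine ⟨c, H, hHV, ?_, hmono⟩
        rw [hH, Function.update_of_ne hcc]

/-- Finite Ramsey theorem for products of hypergraphs. -/
theorem exists_monochromatic_subgrid {α : Type*} (r n k : ℕ) (κ : Type*) [Finite κ] :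
    ∃ M : ℕ, ∀ V : Fin k → Finset α, (∀ i, M ≤ (V i).card) →
      ∀ χ : (Fin k → Finset α) → κ, ∃ c, ∃ H : Fin k → Finset α,
        (∀ i, H i ⊆ V i ∧ (H i).card = n) ∧
        ∀ U : Fin k → Finset α, (∀ i, U i ⊆ H i ∧ (U i).card = r) → χ U = c := by
  classical
  induction k generalizing κ with
  | zero =>
    refine ⟨0, fun V _ χ => ⟨χ V, V, fun i => i.elim0, fun U _ => ?_⟩⟩
    rw [Subsingleton.elim U V]
  | succ k ih =>
    obtain ⟨M, hM⟩ := ih κ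
    obtain ⟨L, hL⟩ := exists_monochromatic_subset_sizes (α := α)
      (κ := (Fin k → Finset (Fin M)) → κ) r (fun _ => n)
    refine ⟨max M L, fun V hV χ => ?_⟩
    choose W hWV hW using fun i : Fin k =>
      Finset.exists_subset_card_eq ((le_max_left M L).trans (hV i.succ))
    let emb : (i : Fin k) → Fin M → α := fun i a => ((W i).equivFinOfCardEq (hW i)).symm a
    have hemb : ∀ i, ∀ B ⊆ W i, ∃ B' : Finset (Fin M), B'.image (emb i) = B := by
      intro i B hB
      refine ⟨(Finset.univ : Finset (Fin M)).filter (fun a => emb i a ∈ B), ?_⟩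
      ext x
      simp only [Finset.mem_image, Finset.mem_filter, Finset.mem_univ, true_and]
      constructor
      · rintro ⟨a, ha, rfl⟩
        exact ha
      · intro hx
        have : emb i ((W i).equivFinOfCardEq (hW i) ⟨x, hB hx⟩) = x := by simp [emb]
        exact ⟨_, by rwa [this], this⟩
    obtain ⟨g, H₀, hH₀V, hH₀, hg⟩ := hL (V 0) ((le_max_right M L).trans (hV 0))
      (fun B U => χ (Fin.cons B fun i => (U i).image (emb i)))
    by_cases hB₀ : ∃ B₀ ⊆ H₀, B₀.card = r
    · obtain ⟨B₀, hB₀, hB₀c⟩ := hB₀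
      obtain ⟨c, H, hH, hc⟩ := hM W (fun i => (hW i).ge) (fun U => χ (Fin.cons B₀ U))
      refine ⟨c, Fin.cons H₀ H, fun i => ?_, fun U hU => ?_⟩
      · refine Fin.cases ⟨hH₀V, hH₀⟩ (fun i => ?_) i
        exact ⟨(hH i).1.trans (hWV i), (hH i).2⟩
      · have hU' : ∀ i : Fin k, U i.succ ⊆ H i ∧ (U i.succ).card = r := fun i => hU i.succ
        choose U' hU'' using fun i => hemb i (U i.succ) ((hU' i).1.trans (hH i).1)
        have h1 := congrFun (hg (U 0) (hU 0).1 (hU 0).2) U'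
        have h2 := congrFun (hg B₀ hB₀ hB₀c) U'
        have h3 := hc (fun i => U i.succ) hU'
        simp only [hU''] at h1 h2
        rw [← h3, h2, ← h1]
        congr 1
        exact (Fin.cons_self_tail U).symm
    · obtain ⟨c, H, hH, hc⟩ := hM W (fun i => (hW i).ge) (fun U => χ (Fin.cons ∅ U))
      refine ⟨c, Fin.cons H₀ H, fun i => ?_, fun U hU => ?_⟩
      · refine Fin.cases ⟨hH₀V, hH₀⟩ (fun i => ?_) i
        exact ⟨(hH i).1.trans (hWV i), (hH i).2⟩
      · exact absurd ⟨U 0, (hU 0).1, (hU 0).2⟩ hB₀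

/-- Colorful Helly theorem for finite families of compact convex sets. -/
theorem colorful_helly {E : Type*} [NormedAddCommGroup E] [InnerProductSpace ℝ E]
    [FiniteDimensional ℝ E] {d : ℕ} (hdim : Module.finrank ℝ E = d) (hd : 0 < d) {ι : Type*}
    (U : Fin (d + 1) → Finset ι) (K : Fin (d + 1) → ι → Set E)
    (hconv : ∀ i, ∀ a ∈ U i, Convex ℝ (K i a)) (hcomp : ∀ i, ∀ a ∈ U i, IsCompact (K i a))
    (hK : ∀ t : Fin (d + 1) → ι, (∀ i, t i ∈ U i) → (⋂ i, K i (t i)).Nonempty) :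
    ∃ i z, ∀ a ∈ U i, z ∈ K i a := by
  classical
  by_cases hU : ∀ i, (U i).Nonempty
  swap
  · push Not at hU
    obtain ⟨i, hi⟩ := hU
    exact ⟨i, 0, by simp [hi]⟩
  let L : Fin (d + 1) × (Fin (d + 1) → ι) → Set E :=
    fun q => ⋂ j ∈ ({q.1}ᶜ : Set (Fin (d + 1))), K j (q.2 j)
  have hnt : ∀ i : Fin (d + 1), ({i}ᶜ : Set (Fin (d + 1))).Nonempty := fun i => by
    have : Nontrivial (Fin (d + 1)) := Fin.nontrivial_iff_two_le.2 (by omega)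
    obtain ⟨j, hj⟩ := exists_ne i
    exact ⟨j, hj⟩
  have hLcomp : ∀ i t, (∀ i, t i ∈ U i) → IsCompact (L (i, t)) := fun i t ht => by
    obtain ⟨j, hj⟩ := hnt i
    refine (hcomp j _ (ht j)).of_isClosed_subset ?_ (Set.biInter_subset_of_mem hj)
    exact isClosed_biInter fun j _ => (hcomp j _ (ht j)).isClosed
  have hLconv : ∀ i t, (∀ i, t i ∈ U i) → Convex ℝ (L (i, t)) := fun i t ht =>
    convex_iInter₂ fun j _ => hconv j _ (ht j)
  have hsub : ∀ i t, ⋂ j, K j (t j) ⊆ L (i, t) := fun i t =>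
    Set.subset_iInter₂ fun j _ => Set.iInter_subset _ j
  obtain ⟨⟨i, t⟩, hmem, hmax⟩ := Finset.exists_max_image
    ((Finset.univ : Finset (Fin (d + 1))) ×ˢ Fintype.piFinset U)
    (fun q => Metric.infDist 0 (L q))
    (by simpa using hU)
  simp only [Finset.mem_product, Finset.mem_univ, true_and, Fintype.mem_piFinset] at hmem hmax
  obtain ⟨y, hyL, hy⟩ := (hLcomp i t hmem).exists_infDist_eq_dist ((hK t hmem).mono (hsub i t)) 0
  refine ⟨i, y, fun a ha => ?_⟩
  by_contra hya
  let t' := Function.update t i a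
  have ht' : ∀ j, t' j ∈ U j := fun j => by
    by_cases h : j = i
    · subst h; simpa [t'] using ha
    · simpa [t', h] using hmem j
  have hLt' : L (i, t') = L (i, t) := by
    refine Set.iInter₂_congr fun j hj => ?_
    have : j ≠ i := hj
    simp [t', this]
  have hcompI : IsCompact (⋂ j, K j (t' j)) :=
    (hcomp i _ (ht' i)).of_isClosed_subset
      (isClosed_iInter fun j => (hcomp j _ (ht' j)).isClosed) (Set.iInter_subset _ i)
  obtain ⟨y', hy'I, hy'⟩ := hcompI.exists_infDist_eq_dist (hK t' ht') 0
  have hy'L : y' ∈ L (i, t) := hLt' ▸ hsub i t' hy'I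
  have hne : y ≠ y' := by
    rintro rfl
    exact hya (by simpa [t'] using Set.mem_iInter.1 hy'I i)
  have hlt : ‖y‖ < ‖y'‖ := by
    have hmin : ∀ x ∈ L (i, t), ‖y‖ ≤ ‖x‖ := fun x hx => by
      simpa [hy] using Metric.infDist_le_dist_of_mem (x := (0 : E)) hx
    refine lt_of_le_of_ne (hmin _ hy'L) fun heq => ?_
    have hmid := hmin _ ((hLconv i t hmem) hyL hy'L (by norm_num : (0 : ℝ) ≤ 1 / 2)
      (by norm_num : (0 : ℝ) ≤ 1 / 2) (by norm_num))
    have := norm_combo_lt_of_ne le_rfl heq.symm.le hne (by norm_num : (0 : ℝ) < 1 / 2)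
      (by norm_num : (0 : ℝ) < 1 / 2) (by norm_num)
    exact absurd hmid (not_le.2 this)
  have hmin' : ∀ x ∈ ⋂ j, K j (t' j), ‖y'‖ ≤ ‖x‖ := fun x hx => by
    simpa [hy'] using Metric.infDist_le_dist_of_mem (x := (0 : E)) hx
  let G : Option (Fin (d + 1)) → Set E := fun o => o.elim (Metric.ball 0 ‖y'‖) fun j => K j (t' j)
  have hG : (⋂ o ∈ (Finset.univ : Finset (Option (Fin (d + 1)))), G o).Nonempty := by
    refine Convex.helly_theorem' (𝕜 := ℝ) (fun o _ => ?_) fun I _ hI => ?_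
    · cases o with
      | none => exact convex_ball _ _
      | some j => exact hconv j _ (ht' j)
    · rw [hdim] at hI
      by_cases hnone : none ∈ I
      · obtain ⟨j, hj⟩ : ∃ j, some j ∉ I := by
          by_contra! hall
          have : I = Finset.univ := by
            ext o
            cases o <;> simp [hnone, hall]
          simp [this] at hI
        have hjL := hmax (j, t') ht'
        obtain ⟨x, hxL, hx⟩ :=
          (hLcomp j t' ht').exists_infDist_eq_dist ((hK t' ht').mono (hsub j t')) 0
        rw [hx, hy, dist_zero_left, dist_zero_left] at hjL
        refine ⟨x, Set.mem_iInter₂.2 fun o ho => ?_⟩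
        cases o with
        | none => simpa [G] using hjL.trans_lt hlt
        | some l => exact Set.mem_iInter₂.1 hxL l fun h => hj ((show l = j from h) ▸ ho)
      · refine ⟨y', Set.mem_iInter₂.2 fun o ho => ?_⟩
        cases o with
        | none => exact absurd ho hnone
        | some l => exact Set.mem_iInter.1 hy'I l
  obtain ⟨x, hx⟩ := hG
  have hx' := fun o => Set.mem_iInter₂.1 hx o (Finset.mem_univ _)
  have h1 : ‖x‖ < ‖y'‖ := by simpa [G] using hx' none
  exact absurd (hmin' x (Set.mem_iInter.2 fun j => hx' (some j))) (not_le.2 h1)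

/-- The matrix of edge vectors of a simplex issuing from its first vertex. -/
def edgeMatrix {d : ℕ} (v : Fin (d + 1) → EuclideanSpace ℝ (Fin d)) : Matrix (Fin d) (Fin d) ℝ :=
  Matrix.of fun i j => v i.succ j - v 0 j

/-- The `j`-th coordinate with respect to the edge vectors of a simplex. -/
noncomputable def edgeCoord {d : ℕ} (v : Fin (d + 1) → EuclideanSpace ℝ (Fin d)) (j : Fin d) :
    EuclideanSpace ℝ (Fin d) →ₗ[ℝ] ℝ where
  toFun y := Matrix.vecMul y.ofLp (edgeMatrix v)⁻¹ j
  map_add' y z := by simp [Matrix.add_vecMul]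
  map_smul' c y := by simp [Matrix.smul_vecMul]

section Simplex

variable {d : ℕ} {v : Fin (d + 1) → EuclideanSpace ℝ (Fin d)}

theorem edgeCoord_sub_eq_det_div (j : Fin d) (x : EuclideanSpace ℝ (Fin d)) :
    edgeCoord v j (x - v 0) =
      (edgeMatrix (Function.update v j.succ x)).det / (edgeMatrix v).det := by
  have h1 : edgeMatrix (Function.update v j.succ x) =
      (edgeMatrix v).updateRow j (x - v 0).ofLp := by
    ext i l
    by_cases h : i = j
    · subst h
      simp [edgeMatrix, Function.update_of_ne (Fin.succ_ne_zero i).symm]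
    · simp [edgeMatrix, h, Function.update_of_ne (Fin.succ_ne_zero j).symm]
  rw [h1, ← Matrix.cramer_transpose_apply, Matrix.cramer_eq_adjugate_mulVec,
    ← Matrix.adjugate_transpose, Matrix.mulVec_transpose]
  simp [edgeCoord, Matrix.inv_def, Matrix.vecMul_smul, div_eq_inv_mul]

theorem edgeMatrix_eq_mul (hv : (edgeMatrix v).det ≠ 0)
    (v' : Fin (d + 1) → EuclideanSpace ℝ (Fin d)) :
    edgeMatrix v' =
      Matrix.of (fun i j => edgeCoord v j (v' i.succ - v' 0)) * edgeMatrix v := by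
  have h : Matrix.of (fun i j => edgeCoord v j (v' i.succ - v' 0)) =
      edgeMatrix v' * (edgeMatrix v)⁻¹ := by
    ext i j
    simp [edgeCoord, edgeMatrix, Matrix.mul_apply, Matrix.vecMul, dotProduct]
  rw [h, Matrix.mul_assoc, Matrix.nonsing_inv_mul _ (isUnit_iff_ne_zero.2 hv), Matrix.mul_one]

theorem sum_edgeCoord_smul (hv : (edgeMatrix v).det ≠ 0) (y : EuclideanSpace ℝ (Fin d)) :
    ∑ j, edgeCoord v j y • (v j.succ - v 0) = y := by
  have h : Matrix.vecMul (Matrix.vecMul y.ofLp (edgeMatrix v)⁻¹) (edgeMatrix v) = y.ofLp := by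
    rw [Matrix.vecMul_vecMul, Matrix.nonsing_inv_mul _ (isUnit_iff_ne_zero.2 hv),
      Matrix.vecMul_one]
  ext l
  rw [← h]
  simp [Matrix.vecMul, dotProduct, edgeCoord, edgeMatrix]

theorem linearMap_eq_zero_of_edgeMatrix (hv : (edgeMatrix v).det ≠ 0)
    (f : EuclideanSpace ℝ (Fin d) →ₗ[ℝ] ℝ) (hf : ∀ l, f (v l) = f (v 0)) : f = 0 := by
  ext y
  rw [← sum_edgeCoord_smul hv y]
  simp [map_sum, hf]

theorem abs_det_edgeMatrix_le (hv : (edgeMatrix v).det ≠ 0)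
    (v' : Fin (d + 1) → EuclideanSpace ℝ (Fin d)) {B : ℝ}
    (hB : ∀ i j : Fin d, |edgeCoord v j (v' i.succ) - edgeCoord v j (v' 0)| ≤ B) :
    |(edgeMatrix v').det| ≤ d.factorial * B ^ d * |(edgeMatrix v).det| := by
  rw [edgeMatrix_eq_mul hv v', Matrix.det_mul, abs_mul]
  gcongr
  have := Matrix.det_le (abv := AbsoluteValue.abs) (x := B)
    (A := Matrix.of fun i j => edgeCoord v j (v' i.succ - v' 0))
    (fun i j => by simpa [map_sub] using hB i j)
  simpa using this

theorem exists_det_edgeMatrix_ne_zero {P : Set (EuclideanSpace ℝ (Fin d))}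
    (hP : affineSpan ℝ P = ⊤) :
    ∃ v : Fin (d + 1) → EuclideanSpace ℝ (Fin d), (∀ i, v i ∈ P) ∧ (edgeMatrix v).det ≠ 0 := by
  obtain ⟨s, hsP, b, hb⟩ := AffineBasis.exists_affine_subbasis hP
  have : Finite s := b.finite
  cases nonempty_fintype s
  have hcard : Fintype.card s = d + 1 := by
    simpa using b.card_eq_finrank_add_one
  let e := (Fintype.equivFinOfCardEq hcard).symm
  refine ⟨fun i => b (e i), fun i => by rw [hb]; exact hsP (e i).2, ?_⟩
  have hind : AffineIndependent ℝ (fun i => b (e i)) := b.ind.comp_embedding e.toEmbedding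
  rw [affineIndependent_iff_linearIndependent_vsub ℝ _ (0 : Fin (d + 1))] at hind
  have hind2 := hind.comp (fun i : Fin d => (⟨i.succ, Fin.succ_ne_zero i⟩ :
    {x : Fin (d + 1) // x ≠ 0})) (fun i j h => Fin.succ_injective _ (congrArg Subtype.val h))
  have hind3 := hind2.map' (WithLp.linearEquiv 2 ℝ (Fin d → ℝ)).toLinearMap (LinearEquiv.ker _)
  rw [← isUnit_iff_ne_zero, ← Matrix.isUnit_iff_isUnit_det,
    ← Matrix.linearIndependent_rows_iff_isUnit]
  exact hind3

theorem volume_edgeCoord_mem_Icc (hv : (edgeMatrix v).det ≠ 0) (a b : ℝ) :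
    volume {x | ∀ j, edgeCoord v j (x - v 0) ∈ Set.Icc a b} =
      ENNReal.ofReal |(edgeMatrix v).det| * ENNReal.ofReal (b - a) ^ d := by
  have hset : {x | ∀ j, edgeCoord v j (x - v 0) ∈ Set.Icc a b} =
      (fun x => x - v 0) ⁻¹' ((MeasurableEquiv.toLp 2 (Fin d → ℝ)).symm ⁻¹'
        (Matrix.toLin' ((edgeMatrix v)⁻¹).transpose ⁻¹'
          (Set.Icc (fun _ => a) (fun _ => b)))) := by
    ext x
    simp only [Set.mem_ofPred_eq, Set.mem_preimage, Set.mem_Icc, Pi.le_def, forall_and,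
      Matrix.toLin'_apply, Matrix.mulVec_transpose]
    rfl
  have hdet : LinearMap.det (Matrix.toLin' ((edgeMatrix v)⁻¹).transpose) =
      ((edgeMatrix v).det)⁻¹ := by
    rw [LinearMap.det_toLin', Matrix.det_transpose, Matrix.det_nonsing_inv, Ring.inverse_eq_inv]
  rw [hset]
  simp only [sub_eq_add_neg _ (v 0)]
  rw [measure_preimage_add_right,
    (EuclideanSpace.volume_preserving_symm_measurableEquiv_toLp (Fin d)).measure_preimage_equiv,
    Measure.addHaar_preimage_linearMap _ (by rw [hdet]; exact inv_ne_zero hv), hdet,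
    Real.volume_Icc_pi]
  simp

theorem exists_le_abs_det_edgeMatrix {C : Set (EuclideanSpace ℝ (Fin d))} (hC : 1 ≤ volume C) :
    ∃ v : Fin (d + 1) → EuclideanSpace ℝ (Fin d), (∀ i, v i ∈ C) ∧
      ((4 : ℝ) ^ d)⁻¹ ≤ |(edgeMatrix v).det| := by
  by_contra! hsmall
  have hspan : affineSpan ℝ C = ⊤ := by
    by_contra h
    have h0 := measure_mono_null (subset_affineSpan ℝ C)
      (Measure.addHaar_affineSubspace volume _ h)
    simp [h0] at hC
  obtain ⟨u, huC, hu⟩ := exists_det_edgeMatrix_ne_zero hspan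
  let S : Set ℝ := {r | ∃ v : Fin (d + 1) → EuclideanSpace ℝ (Fin d), (∀ i, v i ∈ C) ∧
    |(edgeMatrix v).det| = r}
  have hSb : BddAbove S := ⟨((4 : ℝ) ^ d)⁻¹, by
    rintro r ⟨v, hv, rfl⟩
    exact (hsmall v hv).le⟩
  have hpos : 0 < sSup S := (abs_pos.2 hu).trans_le (le_csSup hSb ⟨u, huC, rfl⟩)
  obtain ⟨_, ⟨v, hvC, rfl⟩, hv⟩ := exists_lt_of_lt_csSup (s := S) ⟨_, u, huC, rfl⟩ (half_lt_self hpos)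
  have hv0 : (edgeMatrix v).det ≠ 0 := abs_pos.1 ((half_pos hpos).trans hv)
  have hsub : C ⊆ {x | ∀ j, edgeCoord v j (x - v 0) ∈ Set.Icc (-2 : ℝ) 2} := fun x hx j => by
    rw [edgeCoord_sub_eq_det_div, Set.mem_Icc, ← abs_le, abs_div, div_le_iff₀ (abs_pos.2 hv0)]
    have : |(edgeMatrix (Function.update v j.succ x)).det| ≤ sSup S :=
      le_csSup hSb ⟨_, fun i => by
        by_cases h : i = j.succ
        · subst h; simpa using hx
        · simpa [h] using hvC i, rfl⟩
    linarith
  have hvol := hC.trans (measure_mono hsub)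
  rw [volume_edgeCoord_mem_Icc hv0, ← ENNReal.ofReal_pow (by norm_num),
    ← ENNReal.ofReal_mul (abs_nonneg _), ENNReal.one_le_ofReal] at hvol
  have h4 : (0 : ℝ) < 4 ^ d := by positivity
  have := mul_lt_mul_of_pos_right (hsmall v hvC) h4
  rw [inv_mul_cancel₀ h4.ne'] at this
  norm_num at hvol
  linarith

theorem abs_det_edgeMatrix_le_of_volume_le (hd : 0 < d) {X : Set (EuclideanSpace ℝ (Fin d))}
    (hX : Convex ℝ X) {ε : ℝ} (hε : 0 ≤ ε) (hvol : volume X ≤ ENNReal.ofReal ε)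
    (hv : ∀ i, v i ∈ X) : |(edgeMatrix v).det| ≤ d ^ d * ε := by
  have hd' : (0 : ℝ) < d := by exact_mod_cast hd
  by_cases hv0 : (edgeMatrix v).det = 0
  · rw [hv0, abs_zero]; positivity
  have hsub : {x | ∀ j, edgeCoord v j (x - v 0) ∈ Set.Icc (0 : ℝ) (d : ℝ)⁻¹} ⊆ X := fun x hx => by
    have hsum : ∑ j, edgeCoord v j (x - v 0) ≤ 1 := by
      refine (Finset.sum_le_sum fun j _ => (hx j).2).trans ?_
      simp [hd'.ne']
    have hmem := hX.sum_mem (t := Finset.univ)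
      (w := Fin.cons (1 - ∑ j, edgeCoord v j (x - v 0)) fun j => edgeCoord v j (x - v 0)) (z := v)
      (fun i _ => by
        refine Fin.cases ?_ (fun j => ?_) i
        · simpa using hsum
        · exact (hx j).1)
      (by simp [Fin.sum_univ_succ]) (fun i _ => hv i)
    have : ∑ i, (Fin.cons (1 - ∑ j, edgeCoord v j (x - v 0))
        (fun j => edgeCoord v j (x - v 0)) : Fin (d + 1) → ℝ) i • v i = x := by
      have h := sum_edgeCoord_smul hv0 (x - v 0)
      simp only [smul_sub, Finset.sum_sub_distrib, ← Finset.sum_smul] at h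
      simp only [Fin.sum_univ_succ, Fin.cons_zero, Fin.cons_succ, sub_smul, one_smul]
      rw [sub_eq_iff_eq_add] at h
      rw [h]
      abel
    rwa [this] at hmem
  have h := (measure_mono hsub).trans hvol
  rw [volume_edgeCoord_mem_Icc hv0, ← ENNReal.ofReal_pow (by simp),
    ← ENNReal.ofReal_mul (abs_nonneg _), ENNReal.ofReal_le_ofReal_iff hε, sub_zero, inv_pow,
    ← div_eq_mul_inv, div_le_iff₀ (by positivity)] at h
  linarith

/-- A finite set spanning only simplices of small volume is confined to finitely many slabs, one
of which is thin relative to any given simplex of large volume. -/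
theorem exists_thin_slabs (hd : 0 < d) {P : Set (EuclideanSpace ℝ (Fin d))} (hfin : P.Finite)
    (hne : P.Nonempty) {c δ R : ℝ} (hR : 0 ≤ R) (hc : 0 < c)
    (hδ : d.factorial * (R * 2) ^ d * δ < c)
    (hP : ∀ v : Fin (d + 1) → EuclideanSpace ℝ (Fin d), (∀ i, v i ∈ P) →
      |(edgeMatrix v).det| ≤ δ) :
    ∃ (f : Fin d → EuclideanSpace ℝ (Fin d) →ₗ[ℝ] ℝ) (a b : Fin d → ℝ),
      (∀ i, ∀ x ∈ P, f i x ∈ Set.Icc (a i) (b i)) ∧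
      ∀ v : Fin (d + 1) → EuclideanSpace ℝ (Fin d), c ≤ |(edgeMatrix v).det| →
        ∃ i l, R * (b i - a i) < |f i (v l) - f i (v 0)| := by
  obtain ⟨u, huP, hu⟩ := Set.exists_max_image
    {v : Fin (d + 1) → EuclideanSpace ℝ (Fin d) | ∀ i, v i ∈ P}
    (fun v => |(edgeMatrix v).det|) (by simpa using Set.Finite.pi' fun _ : Fin (d + 1) => hfin)
    ⟨fun _ => hne.some, fun _ => hne.some_mem⟩
  by_cases hu0 : (edgeMatrix u).det = 0
  · have hspan : affineSpan ℝ P ≠ ⊤ := fun h => by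
      obtain ⟨v, hvP, hv⟩ := exists_det_edgeMatrix_ne_zero h
      have := hu v hvP
      simp [hu0, hv] at this
    obtain ⟨x₀, hx₀⟩ := hne
    have hvs : vectorSpan ℝ P < ⊤ := lt_top_iff_ne_top.2 fun h =>
      hspan ((AffineSubspace.affineSpan_eq_top_iff_vectorSpan_eq_top_of_nonempty ℝ _ _
        ⟨x₀, hx₀⟩).2 h)
    obtain ⟨f, hf0, hf⟩ := Submodule.exists_le_ker_of_lt_top _ hvs
    refine ⟨fun _ => f, fun _ => f x₀, fun _ => f x₀, fun _ x hx => ?_, fun v hv => ?_⟩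
    · have : f (x - x₀) = 0 := hf (vsub_mem_vectorSpan ℝ hx hx₀)
      rw [map_sub, sub_eq_zero] at this
      simp [this]
    · refine ⟨⟨0, hd⟩, ?_⟩
      by_contra! h
      refine hf0 (linearMap_eq_zero_of_edgeMatrix (v := v) (abs_pos.1 (hc.trans_le hv)) f
        fun l => ?_)
      have := h l
      rw [sub_self, mul_zero] at this
      exact sub_eq_zero.1 (abs_nonpos_iff.1 this)
  · refine ⟨edgeCoord u, fun i => edgeCoord u i (u 0) - 1, fun i => edgeCoord u i (u 0) + 1,
      fun j x hx => ?_, fun v hv => ?_⟩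
    · have : |edgeCoord u j (x - u 0)| ≤ 1 := by
        rw [edgeCoord_sub_eq_det_div, abs_div, div_le_one (abs_pos.2 hu0)]
        refine hu _ fun i => ?_
        by_cases h : i = j.succ
        · subst h; simpa using hx
        · simpa [h] using huP i
      rw [map_sub, abs_le] at this
      constructor <;> linarith [this.1, this.2]
    · by_contra! h
      have h1 := abs_det_edgeMatrix_le hu0 v (B := R * 2) fun i j => by
        have := h j i.succ
        ring_nf at this ⊢
        exact this
      have h2 : d.factorial * (R * 2) ^ d * |(edgeMatrix u).det| ≤
          d.factorial * (R * 2) ^ d * δ := by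
        gcongr
        exact hP u huP
      linarith

end Simplex

/-- Convex weights, in general position, for points of a simplex. -/
theorem exists_weights (d k : ℕ) :
    ∃ w : Fin k → Fin (d + 1) → ℝ, (∀ σ l, 0 ≤ w σ l) ∧ (∀ σ, ∑ l, w σ l = 1) ∧
      ∃ R : ℝ, 0 ≤ R ∧ ∀ e : Fin (d + 1) → Fin k, Function.Injective e →
        ∀ (g : Fin (d + 1) → ℝ) (a b : ℝ), (∀ r, ∑ l, w (e r) l * g l ∈ Set.Icc a b) →
          ∀ l, |g l - g 0| ≤ R * (b - a) := by
  classical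
  let s : Fin k → ℝ := fun σ => ∑ l : Fin (d + 1), (σ : ℝ) ^ (l : ℕ)
  have hs : ∀ σ, 0 < s σ := fun σ =>
    Finset.sum_pos' (fun l _ => by positivity) ⟨0, Finset.mem_univ _, by simp⟩
  let w : Fin k → Fin (d + 1) → ℝ := fun σ l => (s σ)⁻¹ * (σ : ℝ) ^ (l : ℕ)
  let W : (Fin (d + 1) → Fin k) → Matrix (Fin (d + 1)) (Fin (d + 1)) ℝ :=
    fun e => Matrix.of fun r l => w (e r) l
  let N : (Fin (d + 1) → Fin k) → ℝ := fun e => ∑ l, ∑ r, |(W e)⁻¹ l r|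
  have hN : ∀ e, 0 ≤ N e := fun e => by positivity
  have hw1 : ∀ σ, ∑ l, w σ l = 1 := fun σ => by
    rw [← Finset.mul_sum]
    exact inv_mul_cancel₀ (hs σ).ne'
  refine ⟨w, fun σ l => mul_nonneg (inv_nonneg.2 (hs σ).le) (by positivity), hw1,
    ∑ e, 2 * N e, Finset.sum_nonneg fun e _ => by linarith [hN e],
    fun e he g a b hg l => ?_⟩
  have hab : 0 ≤ b - a := sub_nonneg.2 ((hg 0).1.trans (hg 0).2)
  have hdet : IsUnit (W e).det := by
    have : W e = Matrix.diagonal (fun r => (s (e r))⁻¹) *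
        Matrix.vandermonde (fun r => ((e r : ℕ) : ℝ)) := by
      ext r l
      simp [W, w, Matrix.vandermonde_apply]
    rw [isUnit_iff_ne_zero, this, Matrix.det_mul, Matrix.det_diagonal]
    refine mul_ne_zero (Finset.prod_ne_zero_iff.2 fun r _ => inv_ne_zero (hs _).ne') ?_
    rw [Matrix.det_vandermonde_ne_zero_iff]
    exact fun r r' h => he (Fin.ext (by simpa using h))
  have key : ∀ l, |g l - a| ≤ N e * (b - a) := fun l => by
    have hg' : g l - a = ∑ r, (W e)⁻¹ l r * ((∑ l', w (e r) l' * g l') - a) := by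
      have h := congrFun (Matrix.mulVec_mulVec (fun l => g l - a) (W e)⁻¹ (W e)) l
      rw [Matrix.nonsing_inv_mul _ hdet, Matrix.one_mulVec] at h
      rw [← h]
      rw [Matrix.mulVec, dotProduct]
      refine Finset.sum_congr rfl fun r _ => ?_
      congr 1
      simp only [Matrix.mulVec, dotProduct, W, Matrix.of_apply, mul_sub, Finset.sum_sub_distrib,
        ← Finset.sum_mul, hw1, one_mul]
    rw [hg']
    calc _ ≤ ∑ r, |(W e)⁻¹ l r| * (b - a) := by
          refine (Finset.abs_sum_le_sum_abs _ _).trans (Finset.sum_le_sum fun r _ => ?_)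
          rw [abs_mul]
          gcongr
          rw [abs_of_nonneg (sub_nonneg.2 (hg r).1)]
          linarith [(hg r).2]
      _ = (∑ r, |(W e)⁻¹ l r|) * (b - a) := (Finset.sum_mul ..).symm
      _ ≤ _ := by
          gcongr
          exact Finset.single_le_sum (f := fun l => ∑ r, |(W e)⁻¹ l r|)
            (fun _ _ => by positivity) (Finset.mem_univ l)
  calc |g l - g 0| ≤ |g l - a| + |g 0 - a| := by
        rw [show g l - g 0 = (g l - a) - (g 0 - a) by ring]; exact abs_sub _ _
    _ ≤ 2 * N e * (b - a) := by linarith [key l, key 0]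
    _ ≤ _ := by
        gcongr
        exact Finset.single_le_sum (f := fun e => 2 * N e) (fun e _ => by linarith [hN e])
          (Finset.mem_univ e)

/-- Among finitely many points indexed by transversals, some point lies in all the convex hulls
obtained by fixing one coordinate. -/
theorem exists_mem_convexHull_image {E : Type*} [NormedAddCommGroup E] [InnerProductSpace ℝ E]
    [FiniteDimensional ℝ E] {d : ℕ} (hdim : Module.finrank ℝ E = d) (hd : 0 < d) {ι : Type*}
    (U : Fin (d + 1) → Finset ι) (p : (Fin (d + 1) → ι) → E) :
    ∃ i z, ∀ a ∈ U i, z ∈ convexHull ℝ (p '' {t | (∀ j, t j ∈ U j) ∧ t i = a}) := by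
  refine colorful_helly hdim hd U
    (fun i a => convexHull ℝ (p '' {t | (∀ j, t j ∈ U j) ∧ t i = a}))
    (fun i a _ => convex_convexHull ℝ _) (fun i a _ => ?_) fun t ht => ⟨p t, Set.mem_iInter.2
      fun i => subset_convexHull ℝ _ ⟨t, ⟨ht, rfl⟩, rfl⟩⟩
  refine Set.Finite.isCompact_convexHull _ (Set.Finite.image _ ?_)
  exact (Set.Finite.pi' fun j => (U j).finite_toSet).subset fun t ht => ht.1

/-- Rainbow tuples of large families with small `s`-wise intersections do not exist. -/
theorem exists_forall_not_isRainbow (d s : ℕ) (hd : 0 < d) (hs : 0 < s) :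
    ∃ ε0 > (0 : ℝ), ∃ M : ℕ, 0 < M ∧ ∀ ε : ℝ, 0 < ε → ε ≤ ε0 →
      ∀ F : Fin (d + 1) → Finset (Set (EuclideanSpace ℝ (Fin d))), ¬ IsRainbow d M s 1 ε F := by
  classical
  have : NeZero d := ⟨hd.ne'⟩
  obtain ⟨w, hw0, hw1, R, hR, hwR⟩ := exists_weights d ((d + 1) * d + 1)
  have hc : (0 : ℝ) < (4 ^ d)⁻¹ := by positivity
  obtain ⟨δ, hδ0, hδ⟩ := exists_pos_mul_lt hc (d.factorial * (R * 2) ^ d)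
  obtain ⟨ε0, hε0, hε0δ⟩ := exists_pos_mul_lt hδ0 ((d : ℝ) ^ d)
  obtain ⟨M₂, hM₂⟩ := exists_monochromatic_subgrid (α := Set (EuclideanSpace ℝ (Fin d)))
    1 s (d + 1) (Fin d × Fin (d + 1) × Bool)
  obtain ⟨M₁, hM₁⟩ := exists_monochromatic_subgrid (α := Set (EuclideanSpace ℝ (Fin d)))
    s (max M₂ s) (d + 1) (Fin ((d + 1) * d + 1) → Fin (d + 1))
  refine ⟨ε0, hε0, max M₁ 1, by simp, fun ε hε hεε0 F ⟨hconv, hcard, hvol, hsvol⟩ => ?_⟩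
  have hsimplex : ∀ t : Fin (d + 1) → Set (EuclideanSpace ℝ (Fin d)),
      ∃ v : Fin (d + 1) → EuclideanSpace ℝ (Fin d), (∀ i, t i ∈ F i) →
        (∀ l, v l ∈ ⋂ i, t i) ∧ ((4 : ℝ) ^ d)⁻¹ ≤ |(edgeMatrix v).det| := fun t => by
    by_cases ht : ∀ i, t i ∈ F i
    · obtain ⟨v, hv⟩ := exists_le_abs_det_edgeMatrix (by simpa using hvol t ht)
      exact ⟨v, fun _ => hv⟩
    · exact ⟨0, fun h => absurd h ht⟩
  choose v hv using hsimplex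
  let p : Fin ((d + 1) * d + 1) → (Fin (d + 1) → Set (EuclideanSpace ℝ (Fin d))) →
    EuclideanSpace ℝ (Fin d) := fun σ t => ∑ l, w σ l • v t l
  have hp : ∀ σ t, (∀ i, t i ∈ F i) → ∀ i, p σ t ∈ t i := fun σ t ht i =>
    (hconv i _ (ht i)).sum_mem (fun l _ => hw0 σ l) (hw1 σ)
      fun l _ => Set.mem_iInter.1 ((hv t ht).1 l) i
  choose J z hz using fun σ U =>
    exists_mem_convexHull_image (finrank_euclideanSpace_fin (𝕜 := ℝ) (n := d)) hd U (p σ)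
  obtain ⟨I, H, hH, hI⟩ := hM₁ F (fun i => (le_max_left M₁ 1).trans (hcard i).ge)
    fun U σ => J σ U
  have hHF : ∀ {t : Fin (d + 1) → Set (EuclideanSpace ℝ (Fin d))}, (∀ i, t i ∈ H i) →
    ∀ i, t i ∈ F i := fun ht i => (hH i).1 (ht i)
  obtain ⟨i₀, hi₀⟩ := Fintype.exists_lt_card_fiber_of_mul_lt_card (f := I) (n := d) (by simp)
  let e := Finset.orderEmbOfCardLe _ (Nat.succ_le_of_lt hi₀)
  have he : ∀ r, I (e r) = i₀ := fun r => by
    simpa using Finset.orderEmbOfCardLe_mem _ (Nat.succ_le_of_lt hi₀) r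
  choose T hTH hT using fun i =>
    Finset.exists_subset_card_eq ((le_max_right M₂ s).trans (hH i).2.ge)
  obtain ⟨A₀, hA₀⟩ := Finset.card_pos.1 (hs.trans_eq (hT i₀).symm)
  let grids : Set (Fin (d + 1) → Finset (Set (EuclideanSpace ℝ (Fin d)))) :=
    {U | (∀ i, U i ⊆ H i ∧ (U i).card = s) ∧ U i₀ = T i₀}
  let P : Set (EuclideanSpace ℝ (Fin d)) := Set.image2 (fun r U => z (e r) U) Set.univ grids
  have hzmem : ∀ r, ∀ U ∈ grids, ∀ A ∈ T i₀, z (e r) U ∈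
      convexHull ℝ (p (e r) '' {t | (∀ j, t j ∈ U j) ∧ t i₀ = A}) := fun r U hU A hA => by
    have hJ : J (e r) U = i₀ := (congrFun (hI U hU.1) (e r)).trans (he r)
    have := hz (e r) U
    rw [hJ, hU.2] at this
    exact this A hA
  have hPfin : P.Finite := Set.finite_univ.image2 _
    ((Set.Finite.pi' fun i => (H i).powerset.finite_toSet).subset
      fun U hU i => Finset.mem_coe.2 (Finset.mem_powerset.2 (hU.1 i).1))
  have hPne : P.Nonempty := ⟨_, 0, Set.mem_univ _, T, ⟨fun i => ⟨hTH i, hT i⟩, rfl⟩, rfl⟩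
  have hPT : ∀ x ∈ P, x ∈ ⋂₀ (T i₀ : Set (Set (EuclideanSpace ℝ (Fin d)))) := by
    rintro _ ⟨r, -, U, hU, rfl⟩ A hA
    have hAF : A ∈ F i₀ := (hH i₀).1 (hTH i₀ hA)
    refine convexHull_min ?_ (hconv i₀ A hAF) (hzmem r U hU A hA)
    rintro _ ⟨t, ⟨ht, rfl⟩, rfl⟩
    exact hp _ t (hHF fun i => (hU.1 i).1 (ht i)) i₀
  have hTF : T i₀ ⊆ F i₀ := (hTH i₀).trans (hH i₀).1
  obtain ⟨f, a, b, hfP, hf⟩ := exists_thin_slabs hd hPfin hPne hR hc hδ fun u hu => by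
    refine (abs_det_edgeMatrix_le_of_volume_le hd (convex_sInter fun A hA => hconv i₀ A (hTF hA))
      hε.le (hsvol i₀ _ hTF (hT i₀)) fun i => hPT _ (hu i)).trans ?_
    exact (mul_le_mul_of_nonneg_left hεε0 (by positivity)).trans hε0δ.le
  have hside : ∀ t : Fin (d + 1) → Set (EuclideanSpace ℝ (Fin d)), (∀ i, t i ∈ H i) →
      ∃ q : Fin d × Fin (d + 1) × Bool,
        if q.2.2 then b q.1 < f q.1 (p (e q.2.1) t) else f q.1 (p (e q.2.1) t) < a q.1 :=
      fun t ht => by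
    obtain ⟨i, l, hil⟩ := hf (v t) (hv t (hHF ht)).2
    by_contra! h
    refine hil.not_ge (hwR e e.injective (fun l => f i (v t l)) (a i) (b i) (fun r => ?_) l)
    have hsum : f i (p (e r) t) = ∑ l, w (e r) l * f i (v t l) := by simp [p, map_sum]
    rw [← hsum]
    exact ⟨by simpa using h (i, r, false), by simpa using h (i, r, true)⟩
  choose! q hq using hside
  obtain ⟨⟨i, r, σ⟩, H', hH', hq'⟩ := hM₂ H (fun i => (le_max_left M₂ s).trans (hH i).2.ge)
    fun U => q (Function.update (fun i => ⋃₀ (U i : Set (Set (EuclideanSpace ℝ (Fin d))))) i₀ A₀)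
  let U := Function.update H' i₀ (T i₀)
  have hU : U ∈ grids := by
    refine ⟨fun j => ?_, by simp [U]⟩
    by_cases h : j = i₀
    · subst h; simpa [U] using ⟨hTH j, hT j⟩
    · simpa [U, h] using hH' j
  obtain ⟨A₁, hA₁⟩ := Finset.card_pos.1 (hs.trans_eq (hH' i₀).2.symm)
  have hqU : ∀ t : Fin (d + 1) → Set (EuclideanSpace ℝ (Fin d)), (∀ j, t j ∈ U j) → t i₀ = A₀ →
      if σ then b i < f i (p (e r) t) else f i (p (e r) t) < a i := fun t ht ht₀ => by
    have h := hq' (fun j => {Function.update t i₀ A₁ j}) fun j => by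
      refine ⟨?_, by simp⟩
      by_cases h : j = i₀
      · subst h; simpa using hA₁
      · simpa [U, h] using ht j
    simp only [Finset.coe_singleton, Set.sUnion_singleton, Function.update_idem, ← ht₀,
      Function.update_eq_self] at h
    have := hq t fun j => (hU.1 j).1 (ht j)
    rwa [h] at this
  have hzP := hfP i _ ⟨r, Set.mem_univ _, U, hU, rfl⟩
  have hzU := hzmem r U hU A₀ hA₀
  cases σ
  · have := convexHull_min (t := {x | f i x < a i}) (by
      rintro _ ⟨t, ht, rfl⟩
      simpa using hqU t ht.1 ht.2) (convex_halfSpace_lt (f i).isLinear _) hzU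
    exact this.not_ge hzP.1
  · have := convexHull_min (t := {x | b i < f i x}) (by
      rintro _ ⟨t, ht, rfl⟩
      simpa using hqU t ht.1 ht.2) (convex_halfSpace_gt (f i).isLinear _) hzU
    exact this.not_ge hzP.2

/-- Sparsification lemma for rainbow tuples of families of convex sets. -/
theorem rainbow_sparsify (d s m : ℕ) (hd : 0 < d) (hs : 0 < s) (hm : 0 < m) :
    ∃ ε0 > (0 : ℝ), ∃ α > (0 : ℝ), ∃ M : ℕ, 0 < M ∧
      ∀ ε : ℝ, 0 < ε → ε ≤ ε0 →
      ∀ F : Fin (d + 1) → Finset (Set (EuclideanSpace ℝ (Fin d))),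
        IsRainbow d M s 1 ε F →
        ∃ G : Fin (d + 1) → Finset (Set (EuclideanSpace ℝ (Fin d))),
          (∀ B ⊆ G 0, B.card = s →
            ⋂₀ (B : Set (Set (EuclideanSpace ℝ (Fin d)))) = ∅) ∧
          (∀ i, i ≠ 0 → G i ⊆ F i) ∧
          IsRainbow d m s α ε G := by
  obtain ⟨ε0, hε0, M, hM, h⟩ := exists_forall_not_isRainbow d s hd hs
  exact ⟨ε0, hε0, 1, one_pos, M, hM, fun ε hε hε' F hF => (h ε hε hε' F hF).elim⟩
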